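/- arXiv:1107.1670 — 2 statements merged into one kernel-verified Lean document; each statement's English description precedes it below -/
import Mathlib

section
/- Let E and F be Banach spaces, 1 ≤ p < ∞, and let P : E → F be a p-compact m-homogeneous polynomial with associated continuous symmetric m-linear map P̌. For a ∈ E and 0 ≤ l ≤ m, let P_l(P)(a) be the l-homogeneous polynomial x ↦ binomial(m, m−l) · P̌(a,…,a, x,…,x) (with a appearing m−l times and x appearing l times), i.e., the l-th component of the Taylor series expansion of P at a. Then P_l(P)(a) is p-compact and κ_p(P_l(P)(a)) ≤ (2e)^m ‖a‖^{m−l} κ_p(P). Consequently, the sequence (P_{K_p}(^mE;F), κ_p)_m is a holomorphy type from E to F. -/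
open scoped ENNReal NNReal Classical
open Filter Metric

noncomputable section

/-- Membership in the closed unit ball of `ℓ_q`, where `q` is the conjugate exponent of `p`
(`q = ∞`, i.e. bounded coefficients, when `p = 1`). -/
def ConjUnitBall (p : ℝ) (α : ℕ → ℂ) : Prop :=
  if p = 1 then ∀ n, ‖α n‖ ≤ 1
  else (Summable fun n => ‖α n‖ ^ (p / (p - 1))) ∧ (∑' n, ‖α n‖ ^ (p / (p - 1))) ≤ 1

variable {E F : Type*} [NormedAddCommGroup E] [NormedSpace ℂ E]
  [NormedAddCommGroup F] [NormedSpace ℂ F]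

/-- The `p`-convex hull `p-co{x_n}` of a sequence `(x_n)`. -/
def pCo (p : ℝ) (x : ℕ → F) : Set F :=
  {y | ∃ α : ℕ → ℂ, ConjUnitBall p α ∧ HasSum (fun n => α n • x n) y}

/-- A set is relatively `p`-compact if it is contained in the `p`-convex hull of a
`p`-summable sequence. -/
def IsRelPCompact (p : ℝ) (K : Set F) : Prop :=
  ∃ x : ℕ → F, (Summable fun n => ‖x n‖ ^ p) ∧ K ⊆ pCo p x

/-- The measure of `p`-compactness `m_p(K)`. -/
def mP (p : ℝ) (K : Set F) : ℝ :=
  sInf {r : ℝ | ∃ x : ℕ → F, (Summable fun n => ‖x n‖ ^ p) ∧ K ⊆ pCo p x ∧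
    r = (∑' n, ‖x n‖ ^ p) ^ (1 / p)}

/-- `m_p(K)` as an element of `[0, ∞]`; it equals `∞` when `K` is not relatively
`p`-compact. -/
def mPE (p : ℝ) (K : Set F) : ℝ≥0∞ :=
  sInf {r : ℝ≥0∞ | ∃ x : ℕ → F, (Summable fun n => ‖x n‖ ^ p) ∧ K ⊆ pCo p x ∧
    r = ENNReal.ofReal ((∑' n, ‖x n‖ ^ p) ^ (1 / p))}

/-- The `m`-homogeneous polynomial `P_m f(x₀)` in the Taylor series expansion of `f` at `x₀`. -/
def taylorPoly (f : E → F) (x₀ : E) (m : ℕ) (x : E) : F :=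
  ((m.factorial : ℂ))⁻¹ • iteratedFDeriv ℂ m f x₀ fun _ => x

/-- `f` is `p`-compact at `x₀` if some neighborhood of `x₀` has relatively `p`-compact
image under `f`. -/
def PCompactAt (p : ℝ) (f : E → F) (x₀ : E) : Prop :=
  ∃ V ∈ nhds x₀, IsRelPCompact p (f '' V)

/-- The radius of `p`-compact convergence of `f` at `x₀`:
`r_p(f, x₀) = 1 / limsup κ_p(P_mf(x₀))^{1/m}` (with the conventions `1/0 = ∞`, and
`κ_p(P) = ∞` when `P` is not `p`-compact, so that `r_p(f,x₀) = 0` in that case). -/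
def pRadius (p : ℝ) (f : E → F) (x₀ : E) : ℝ≥0∞ :=
  (Filter.limsup (fun m : ℕ => (mPE p (taylorPoly f x₀ m '' closedBall 0 1)) ^ (1 / (m : ℝ)))
    Filter.atTop)⁻¹

/-- The `m`-homogeneous polynomial associated to a continuous `m`-linear map. -/
def polyEval {m : ℕ} (A : ContinuousMultilinearMap ℂ (fun _ : Fin m => E) F) (x : E) : F :=
  A fun _ => x

/-- Averages of elements of the unit ball of `ℓ_q`, twisted by unimodular scalars, stay in it. -/
lemma ConjUnitBall.average {p : ℝ} (hp : 1 ≤ p) {ι : Type*} (s : Finset ι) (hs : s.Nonempty)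
    (c : ι → ℂ) (hc : ∀ k ∈ s, ‖c k‖ ≤ 1) (α : ι → ℕ → ℂ)
    (hα : ∀ k ∈ s, ConjUnitBall p (α k)) :
    ConjUnitBall p (fun n => (s.card : ℂ)⁻¹ * ∑ k ∈ s, c k * α k n) := by
  have hcard : (0 : ℝ) < s.card := by exact_mod_cast hs.card_pos
  have hw : ∑ _k ∈ s, (s.card : ℝ)⁻¹ = 1 := by
    rw [Finset.sum_const, nsmul_eq_mul, mul_inv_cancel₀ hcard.ne']
  have hnorm : ∀ n, ‖(s.card : ℂ)⁻¹ * ∑ k ∈ s, c k * α k n‖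
      ≤ ∑ k ∈ s, (s.card : ℝ)⁻¹ * ‖α k n‖ := by
    intro n
    rw [norm_mul, norm_inv, Complex.norm_natCast, ← Finset.mul_sum]
    gcongr
    refine (norm_sum_le _ _).trans (Finset.sum_le_sum fun k hk => ?_)
    rw [norm_mul]
    exact mul_le_of_le_one_left (norm_nonneg _) (hc k hk)
  unfold ConjUnitBall at hα ⊢
  split_ifs at hα ⊢ with h
  · intro n
    refine (hnorm n).trans (le_of_le_of_eq (Finset.sum_le_sum fun k hk => ?_) hw)
    exact mul_le_of_le_one_right (by positivity) (hα k hk n)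
  · have hp1 : 0 < p - 1 := sub_pos.2 (lt_of_le_of_ne hp (Ne.symm h))
    have hq : 1 ≤ p / (p - 1) := by rw [le_div_iff₀ hp1]; linarith
    have hbound : ∀ n, ‖(s.card : ℂ)⁻¹ * ∑ k ∈ s, c k * α k n‖ ^ (p / (p - 1))
        ≤ ∑ k ∈ s, (s.card : ℝ)⁻¹ * ‖α k n‖ ^ (p / (p - 1)) := fun n =>
      (Real.rpow_le_rpow (norm_nonneg _) (hnorm n) (by linarith)).trans
        (Real.rpow_arith_mean_le_arith_mean_rpow s _ _ (fun _ _ => by positivity) hw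
          (fun _ _ => norm_nonneg _) hq)
    have hsum : Summable fun n => ∑ k ∈ s, (s.card : ℝ)⁻¹ * ‖α k n‖ ^ (p / (p - 1)) :=
      summable_sum fun k hk => (hα k hk).1.mul_left _
    have hsum' := Summable.of_nonneg_of_le (fun n => by positivity) hbound hsum
    refine ⟨hsum', (hsum'.tsum_le_tsum hbound hsum).trans ?_⟩
    rw [Summable.tsum_finsetSum fun k hk => (hα k hk).1.mul_left _]
    refine le_of_le_of_eq (Finset.sum_le_sum fun k hk => ?_) hw
    rw [tsum_mul_left]
    exact mul_le_of_le_one_right (by positivity) (hα k hk).2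

/-- Averages of elements of `p-co{x_n}`, twisted by unimodular scalars, stay in it. -/
lemma pCo_average {p : ℝ} (hp : 1 ≤ p) {ι : Type*} (s : Finset ι) (hs : s.Nonempty)
    (c : ι → ℂ) (hc : ∀ k ∈ s, ‖c k‖ ≤ 1) (x : ℕ → F) (y : ι → F)
    (hy : ∀ k ∈ s, y k ∈ pCo p x) :
    (s.card : ℂ)⁻¹ • ∑ k ∈ s, c k • y k ∈ pCo p x := by
  choose! α hα hsum using hy
  refine ⟨_, ConjUnitBall.average hp s hs c hc α hα, ?_⟩
  have h := (hasSum_sum fun k hk => (hsum k hk).const_smul (c k)).const_smul (s.card : ℂ)⁻¹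
  convert h using 2 with n
  simp only [mul_smul, Finset.sum_smul]

lemma smul_mem_pCo {p : ℝ} (c : ℂ) {x : ℕ → F} {y : F} (hy : y ∈ pCo p x) :
    c • y ∈ pCo p (fun n => c • x n) := by
  obtain ⟨α, hα, h⟩ := hy
  refine ⟨α, hα, ?_⟩
  simpa only [smul_comm c] using h.const_smul c

lemma norm_smul_rpow_eq {p : ℝ} {c : ℝ} (hc : 0 ≤ c) (x : ℕ → F) (n : ℕ) :
    ‖(c : ℂ) • x n‖ ^ p = c ^ p * ‖x n‖ ^ p := by
  rw [norm_smul, Complex.norm_real, Real.norm_of_nonneg hc,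
    Real.mul_rpow hc (norm_nonneg _)]

/-- If `K ⊆ p-co{x_n}` always implies `S ⊆ p-co{c x_n}`, then `m_p(S) ≤ c m_p(K)`. -/
lemma IsRelPCompact.of_scaled_hull {p : ℝ} (hp : 1 ≤ p) {K S : Set F} {c : ℝ} (hc : 0 ≤ c)
    (hK : IsRelPCompact p K)
    (h : ∀ x : ℕ → F, K ⊆ pCo p x → S ⊆ pCo p (fun n => (c : ℂ) • x n)) :
    IsRelPCompact p S ∧ mP p S ≤ c * mP p K := by
  have hsummable : ∀ x : ℕ → F, (Summable fun n => ‖x n‖ ^ p) →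
      Summable fun n => ‖(c : ℂ) • x n‖ ^ p := fun x hx => by
    simpa only [norm_smul_rpow_eq hc] using hx.mul_left (c ^ p)
  obtain ⟨x₀, hx₀, hKx₀⟩ := hK
  refine ⟨⟨_, hsummable x₀ hx₀, h x₀ hKx₀⟩, ?_⟩
  unfold mP
  rw [← smul_eq_mul, ← Real.sInf_smul_of_nonneg hc]
  refine le_csInf ⟨_, Set.smul_mem_smul_set ⟨x₀, hx₀, hKx₀, rfl⟩⟩ ?_
  rintro _ ⟨_, ⟨x, hx, hKx, rfl⟩, rfl⟩
  refine csInf_le ⟨0, ?_⟩ ⟨_, hsummable x hx, h x hKx, ?_⟩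
  · rintro _ ⟨z, -, -, rfl⟩
    exact Real.rpow_nonneg (tsum_nonneg fun n => by positivity) _
  · simp only [norm_smul_rpow_eq hc, tsum_mul_left]
    rw [Real.mul_rpow (by positivity) (tsum_nonneg fun n => by positivity), ← Real.rpow_mul hc,
      mul_one_div_cancel (by linarith), Real.rpow_one, smul_eq_mul]

lemma polyEval_smul {m : ℕ} (A : ContinuousMultilinearMap ℂ (fun _ : Fin m => E) F)
    (c : ℂ) (x : E) : polyEval A (c • x) = c ^ m • polyEval A x := by
  simpa [polyEval] using A.map_smul_univ (fun _ => c) (fun _ => x)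

lemma polyEval_smul_add {m : ℕ} (A : ContinuousMultilinearMap ℂ (fun _ : Fin m => E) F)
    (c : ℂ) (u x : E) :
    polyEval A (c • u + x) =
      ∑ s : Finset (Fin m), c ^ s.card • A (s.piecewise (fun _ => u) (fun _ => x)) := by
  have h := A.map_add_univ (fun _ => c • u) (fun _ => x)
  refine Eq.trans h (Finset.sum_congr rfl fun s _ => ?_)
  rw [← Finset.prod_const, ← A.map_piecewise_smul (fun _ => c)]
  congr 1
  ext i
  by_cases hi : i ∈ s <;> simp [hi]

/-- A symmetric map at a vector with two distinct entries only depends on their multiplicities. -/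
lemma map_piecewise_eq_of_card_eq {m j : ℕ}
    (A : ContinuousMultilinearMap ℂ (fun _ : Fin m => E) F)
    (hsym : ∀ (v : Fin m → E) (σ : Equiv.Perm (Fin m)), A (v ∘ σ) = A v)
    (u x : E) (s : Finset (Fin m)) (hs : s.card = j) :
    A (s.piecewise (fun _ => u) (fun _ => x)) = A (fun i => if (i : ℕ) < j then u else x) := by
  have hj : j ≤ m := by simpa [hs] using s.card_le_univ
  have hcard : Fintype.card {i // i ∈ s} = Fintype.card {i : Fin m // (i : ℕ) < j} := by
    rw [Fintype.card_coe, hs, Fintype.card_subtype, Fin.card_filter_val_lt, min_eq_right hj]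
  let e := Fintype.equivOfCardEq hcard
  rw [← hsym (fun i => if (i : ℕ) < j then u else x) e.extendSubtype]
  congr 1
  ext i
  by_cases hi : i ∈ s
  · have := e.extendSubtype_mem i hi
    simp [hi, this]
  · have := e.extendSubtype_not_mem i hi
    simp [hi, -not_lt, this]

/-- The Taylor components of `P` are discrete Fourier coefficients of `c ↦ P (c u + x)`. -/
lemma taylor_component_eq_average {m j : ℕ} (hj : j ≤ m)
    (A : ContinuousMultilinearMap ℂ (fun _ : Fin m => E) F)
    (hsym : ∀ (v : Fin m → E) (σ : Equiv.Perm (Fin m)), A (v ∘ σ) = A v)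
    {ω : ℂ} (hω : IsPrimitiveRoot ω (m + 1)) (u x : E) :
    (Nat.choose m j : ℂ) • A (fun i => if (i : ℕ) < j then u else x) =
      ((Finset.range (m + 1)).card : ℂ)⁻¹ • ∑ k ∈ Finset.range (m + 1),
        (ω ^ j)⁻¹ ^ k • polyEval A (ω ^ k • u + x) := by
  have hω0 : ω ≠ 0 := hω.ne_zero m.succ_ne_zero
  have horth : ∀ a ≤ m, ∑ k ∈ Finset.range (m + 1), (ω ^ j)⁻¹ ^ k * (ω ^ k) ^ a =
      if a = j then ((m + 1 : ℕ) : ℂ) else 0 := by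
    intro a ha
    have h1 : ∀ k, (ω ^ j)⁻¹ ^ k * (ω ^ k) ^ a = ((ω ^ j)⁻¹ * ω ^ a) ^ k := fun k => by
      rw [mul_pow, ← pow_mul, ← pow_mul, mul_comm k a]
    simp only [h1]
    split_ifs with haj
    · simp [haj, hω0]
    · have hne : (ω ^ j)⁻¹ * ω ^ a ≠ 1 := fun h => haj <|
        hω.pow_inj (Nat.lt_succ_of_le ha) (Nat.lt_succ_of_le hj)
          ((inv_mul_eq_one₀ (pow_ne_zero _ hω0)).1 h).symm
      rw [geom_sum_eq hne, mul_pow, inv_pow, ← pow_mul, ← pow_mul, mul_comm j, mul_comm a,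
        pow_mul, pow_mul, hω.pow_eq_one]
      simp
  simp only [polyEval_smul_add, Finset.smul_sum, smul_smul]
  rw [Finset.sum_comm]
  simp only [← Finset.sum_smul, ← Finset.mul_sum]
  have h2 : ∀ s : Finset (Fin m),
      (((Finset.range (m + 1)).card : ℂ)⁻¹ *
        ∑ k ∈ Finset.range (m + 1), (ω ^ j)⁻¹ ^ k * (ω ^ k) ^ s.card) •
          A (s.piecewise (fun _ => u) (fun _ => x)) =
      if s.card = j then A (fun i => if (i : ℕ) < j then u else x) else 0 := by
    intro s
    rw [horth _ (by simpa using s.card_le_univ), Finset.card_range]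
    split_ifs with h
    · rw [inv_mul_cancel₀ (Nat.cast_ne_zero.2 m.succ_ne_zero), one_smul,
        map_piecewise_eq_of_card_eq A hsym u x s h]
    · simp
  simp only [h2]
  rw [← Finset.sum_filter, Finset.sum_const, Finset.univ_filter_card_eq,
    Finset.card_powersetCard, Finset.card_univ, Fintype.card_fin, Nat.cast_smul_eq_nsmul]

/-- The Taylor component at `a` maps the unit ball into `2^m ‖a‖^j p-co{x_n}` as soon as
`P` maps it into `p-co{x_n}`. -/
lemma taylor_component_subset_pCo {p : ℝ} (hp : 1 ≤ p) {m j : ℕ} (hj : j ≤ m)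
    (A : ContinuousMultilinearMap ℂ (fun _ : Fin m => E) F)
    (hsym : ∀ (v : Fin m → E) (σ : Equiv.Perm (Fin m)), A (v ∘ σ) = A v)
    (a : E) (z : ℕ → F) (hz : polyEval A '' closedBall 0 1 ⊆ pCo p z) :
    (fun x => (Nat.choose m j : ℂ) • A fun i => if (i : ℕ) < j then a else x) ''
        closedBall 0 1 ⊆
      pCo p (fun n => ((2 ^ m * ‖a‖ ^ j : ℝ) : ℂ) • z n) := by
  rintro _ ⟨x, hx, rfl⟩
  rw [mem_closedBall_zero_iff] at hx
  obtain ⟨ω, hω⟩ : ∃ ω : ℂ, IsPrimitiveRoot ω (m + 1) :=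
    ⟨_, Complex.isPrimitiveRoot_exp _ m.succ_ne_zero⟩
  have hω1 : ‖ω‖ = 1 := hω.norm'_eq_one m.succ_ne_zero
  obtain ⟨u, hu, hau⟩ : ∃ u : E, ‖u‖ ≤ 1 ∧ a = (‖a‖ : ℂ) • u := by
    refine ⟨(‖a‖ : ℂ)⁻¹ • a, ?_, ?_⟩
    · rw [norm_smul, norm_inv, Complex.norm_real, norm_norm]
      exact inv_mul_le_one
    · rcases eq_or_ne a 0 with rfl | ha
      · simp
      · rw [smul_inv_smul₀ (by simpa using ha)]
  have hscale : A (fun i => if (i : ℕ) < j then a else x) =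
      (‖a‖ : ℂ) ^ j • A (fun i => if (i : ℕ) < j then u else x) := by
    have h := A.map_piecewise_smul (fun _ => (‖a‖ : ℂ))
      (fun i : Fin m => if (i : ℕ) < j then u else x)
      (Finset.univ.filter fun i : Fin m => (i : ℕ) < j)
    rw [Finset.prod_const, Fin.card_filter_val_lt, min_eq_right hj] at h
    rw [← h]
    congr 1
    ext i
    by_cases hi : (i : ℕ) < j
    · simpa [hi] using hau
    · simp [hi]
  have hmem : ∀ k ∈ Finset.range (m + 1),
      polyEval A (ω ^ k • u + x) ∈ pCo p (fun n => (2 : ℂ) ^ m • z n) := by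
    intro k _
    have h2 : ω ^ k • u + x = (2 : ℂ) • ((2 : ℂ)⁻¹ • (ω ^ k • u + x)) := by
      rw [smul_inv_smul₀ two_ne_zero]
    rw [h2, polyEval_smul]
    refine smul_mem_pCo _ (hz ⟨_, ?_, rfl⟩)
    have h3 : ‖ω ^ k • u + x‖ ≤ 2 := by
      refine (norm_add_le _ _).trans ?_
      rw [norm_smul, norm_pow, hω1, one_pow, one_mul]
      linarith
    rw [mem_closedBall_zero_iff, norm_smul, norm_inv, Complex.norm_ofNat]
    linarith
  have havg := smul_mem_pCo ((‖a‖ : ℂ) ^ j) <|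
    pCo_average hp (Finset.range (m + 1)) Finset.nonempty_range_add_one
      (fun k => (ω ^ j)⁻¹ ^ k) (fun k _ => by simp [hω1]) _ _ hmem
  rw [← taylor_component_eq_average hj A hsym hω u x] at havg
  simp only [hscale]
  rw [smul_comm]
  convert havg using 2
  ext n
  rw [smul_smul]
  push_cast
  rw [mul_comm]

/-- **Theorem 5.1 (holomorphy type estimate).** Let `E`, `F` be Banach spaces, `1 ≤ p < ∞`,
and let `P : E → F` be a `p`-compact `m`-homogeneous polynomial with associated continuous
symmetric `m`-linear map `P̌`.  For `a ∈ E` and `0 ≤ l ≤ m`, the `l`-th Taylor component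
`P_l(P)(a)(x) = C(m, m-l) P̌(a^{m-l}, x^l)` of `P` at `a` is `p`-compact and satisfies
`κ_p(P_l(P)(a)) ≤ (2e)^m ‖a‖^{m-l} κ_p(P)`.  (This makes `(P_{K_p}(^mE;F), κ_p)_m`
a holomorphy type from `E` to `F`.) -/
theorem statement17 [CompleteSpace E] [CompleteSpace F] (p : ℝ) (hp : 1 ≤ p)
    (m : ℕ) (A : ContinuousMultilinearMap ℂ (fun _ : Fin m => E) F)
    (hsym : ∀ (v : Fin m → E) (σ : Equiv.Perm (Fin m)), A (v ∘ σ) = A v)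
    (hP : IsRelPCompact p (polyEval A '' closedBall 0 1)) (a : E)
    (l : ℕ) (hl : l ≤ m) :
    IsRelPCompact p
      ((fun x => (Nat.choose m (m - l) : ℂ) •
          A fun i => if (i : ℕ) < m - l then a else x) '' closedBall 0 1) ∧
    mP p ((fun x => (Nat.choose m (m - l) : ℂ) •
          A fun i => if (i : ℕ) < m - l then a else x) '' closedBall 0 1) ≤
      (2 * Real.exp 1) ^ m * ‖a‖ ^ (m - l) * mP p (polyEval A '' closedBall 0 1) := by
  obtain ⟨hcomp, hle⟩ := hP.of_scaled_hull hp (by positivity)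
    (taylor_component_subset_pCo hp (Nat.sub_le m l) A hsym a)
  refine ⟨hcomp, hle.trans ?_⟩
  have hnonneg : 0 ≤ mP p (polyEval A '' closedBall 0 1) := by
    refine Real.sInf_nonneg ?_
    rintro _ ⟨z, -, -, rfl⟩
    exact Real.rpow_nonneg (tsum_nonneg fun n => by positivity) _
  have he : (1 : ℝ) ≤ Real.exp 1 := Real.one_le_exp zero_le_one
  gcongr
  linarith

end
end

section
/- Let E and F be complex Banach spaces, 1 ≤ p < ∞, and let f : E → F be entire. Then f is p-compact (i.e., p-compact at every point of E) if and only if every Taylor polynomial P_mf(0) is p-compact and, for every absolutely convex compact subset K of E, there exists ε > 0 such that ∑_{m=0}^∞ m_p(P_mf(0)(K + εB_E)) < ∞. -/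
open scoped ENNReal NNReal Classical
open Filter Metric

noncomputable section

variable {E F : Type*} [NormedAddCommGroup E] [NormedSpace ℂ E]
  [NormedAddCommGroup F] [NormedSpace ℂ F]

open scoped Pointwise

theorem conjUnitBall_iff_of_ne_one {p : ℝ} (hp : p ≠ 1) {α : ℕ → ℂ} :
    ConjUnitBall p α ↔ ∀ s : Finset ℕ, ∑ n ∈ s, ‖α n‖ ^ (p / (p - 1)) ≤ 1 := by
  rw [ConjUnitBall, if_neg hp]
  constructor
  · rintro ⟨h1, h2⟩ s
    exact (h1.sum_le_tsum s fun n _ => by positivity).trans h2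
  · intro h
    have hs := summable_of_sum_le (fun n => by positivity) h
    exact ⟨hs, hs.tsum_le_of_sum_le h⟩

theorem ConjUnitBall.norm_le_one {p : ℝ} (hp : 1 ≤ p) {α : ℕ → ℂ} (h : ConjUnitBall p α) (n : ℕ) :
    ‖α n‖ ≤ 1 := by
  by_cases h1 : p = 1
  · rw [ConjUnitBall, if_pos h1] at h
    exact h n
  · have hp1 : 1 < p := lt_of_le_of_ne hp (Ne.symm h1)
    have := (conjUnitBall_iff_of_ne_one h1).1 h {n}
    rw [Finset.sum_singleton] at this
    have hq : 0 < p / (p - 1) := div_pos (by linarith) (by linarith)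
    contrapose! this
    exact Real.one_lt_rpow this hq

theorem ConjUnitBall.of_norm_le {p : ℝ} (hp : 1 ≤ p) {α β : ℕ → ℂ} (h : ConjUnitBall p α)
    (hβ : ∀ n, ‖β n‖ ≤ ‖α n‖) : ConjUnitBall p β := by
  by_cases h1 : p = 1
  · rw [ConjUnitBall, if_pos h1] at h ⊢
    exact fun n => (hβ n).trans (h n)
  · have hp1 : 1 < p := lt_of_le_of_ne hp (Ne.symm h1)
    rw [conjUnitBall_iff_of_ne_one h1] at h ⊢
    have hq : 0 < p / (p - 1) := div_pos (by linarith) (by linarith)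
    exact fun s => (Finset.sum_le_sum fun n _ =>
      Real.rpow_le_rpow (norm_nonneg _) (hβ n) hq.le).trans (h s)

theorem conjUnitBall_zero (p : ℝ) (hp : 1 ≤ p) : ConjUnitBall p 0 := by
  by_cases h1 : p = 1
  · rw [ConjUnitBall, if_pos h1]
    simp
  · have hp1 : 1 < p := lt_of_le_of_ne hp (Ne.symm h1)
    rw [conjUnitBall_iff_of_ne_one h1]
    have hq : p / (p - 1) ≠ 0 := (div_pos (by linarith) (by linarith)).ne'
    simp [Real.zero_rpow hq]

theorem convex_conjUnitBall {p : ℝ} (hp : 1 ≤ p) : Convex ℝ {α : ℕ → ℂ | ConjUnitBall p α} := by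
  intro α hα β hβ a b ha hb hab
  have hnorm : ∀ n, ‖(a • α + b • β) n‖ ≤ a * ‖α n‖ + b * ‖β n‖ := fun n => by
    simpa [norm_smul, abs_of_nonneg ha, abs_of_nonneg hb] using norm_add_le (a • α n) (b • β n)
  by_cases h1 : p = 1
  · rw [Set.mem_ofPred_eq, ConjUnitBall, if_pos h1] at *
    intro n
    nlinarith [hnorm n, hα n, hβ n]
  · have hp1 : 1 < p := lt_of_le_of_ne hp (Ne.symm h1)
    rw [Set.mem_ofPred_eq, conjUnitBall_iff_of_ne_one h1] at *
    have hq : 1 ≤ p / (p - 1) := by rw [le_div_iff₀ (by linarith)]; linarith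
    intro s
    calc ∑ n ∈ s, ‖(a • α + b • β) n‖ ^ (p / (p - 1))
        ≤ ∑ n ∈ s, (a * ‖α n‖ ^ (p / (p - 1)) + b * ‖β n‖ ^ (p / (p - 1))) := by
          refine Finset.sum_le_sum fun n _ => ?_
          refine (Real.rpow_le_rpow (norm_nonneg _) (hnorm n) (by linarith)).trans ?_
          exact (convexOn_rpow hq).2 (norm_nonneg (α n)) (norm_nonneg (β n)) ha hb hab
      _ ≤ 1 := by
          rw [Finset.sum_add_distrib, ← Finset.mul_sum, ← Finset.mul_sum]
          nlinarith [hα s, hβ s]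

theorem isClosed_conjUnitBall {p : ℝ} (hp : 1 ≤ p) :
    IsClosed {α : ℕ → ℂ | ConjUnitBall p α} := by
  by_cases h1 : p = 1
  · simp only [ConjUnitBall, if_pos h1, Set.ofPred_forall]
    exact isClosed_iInter fun n => isClosed_le (by fun_prop) continuous_const
  · have hp1 : 1 < p := lt_of_le_of_ne hp (Ne.symm h1)
    have hq : 0 ≤ p / (p - 1) := (div_pos (by linarith) (by linarith)).le
    simp only [conjUnitBall_iff_of_ne_one h1, Set.ofPred_forall]
    refine isClosed_iInter fun s => isClosed_le ?_ continuous_const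
    exact continuous_finsetSum _ fun n _ =>
      (continuous_norm.comp (continuous_apply n)).rpow_const fun _ => Or.inr hq

theorem isCompact_conjUnitBall {p : ℝ} (hp : 1 ≤ p) :
    IsCompact {α : ℕ → ℂ | ConjUnitBall p α} := by
  refine (isCompact_univ_pi fun _ : ℕ => isCompact_closedBall (0 : ℂ) 1).of_isClosed_subset
    (isClosed_conjUnitBall hp) fun α hα n _ => ?_
  simpa using ConjUnitBall.norm_le_one hp hα n

theorem ConjUnitBall.sum_norm_smul_le {p : ℝ} (hp : 1 ≤ p) {α : ℕ → ℂ} (h : ConjUnitBall p α)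
    (x : ℕ → F) (s : Finset ℕ) :
    ∑ n ∈ s, ‖α n • x n‖ ≤ (∑ n ∈ s, ‖x n‖ ^ p) ^ (1 / p) := by
  simp only [norm_smul]
  by_cases h1 : p = 1
  · subst h1
    simp only [Real.rpow_one, div_one]
    exact Finset.sum_le_sum fun n _ =>
      mul_le_of_le_one_left (norm_nonneg _) (h.norm_le_one le_rfl n)
  · have hp1 : 1 < p := lt_of_le_of_ne hp (Ne.symm h1)
    have hpq : (p / (p - 1)).HolderConjugate p := (Real.HolderConjugate.conjExponent hp1).symm
    refine (Real.inner_le_Lp_mul_Lq_of_nonneg s hpq (fun n _ => norm_nonneg _)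
      fun n _ => norm_nonneg _).trans ?_
    refine mul_le_of_le_one_left (by positivity) ?_
    exact Real.rpow_le_one (by positivity) ((conjUnitBall_iff_of_ne_one h1).1 h s)
      (one_div_nonneg.2 hpq.pos.le)

theorem ConjUnitBall.summable_norm_smul {p : ℝ} (hp : 1 ≤ p) {α : ℕ → ℂ} (h : ConjUnitBall p α)
    {x : ℕ → F} (hx : Summable fun n => ‖x n‖ ^ p) :
    (Summable fun n => ‖α n • x n‖) ∧
      ∑' n, ‖α n • x n‖ ≤ (∑' n, ‖x n‖ ^ p) ^ (1 / p) := by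
  have key : ∀ s : Finset ℕ, ∑ n ∈ s, ‖α n • x n‖ ≤ (∑' n, ‖x n‖ ^ p) ^ (1 / p) := fun s =>
    (h.sum_norm_smul_le hp x s).trans <| Real.rpow_le_rpow (by positivity)
      (hx.sum_le_tsum s fun n _ => by positivity) (by positivity)
  have hs := summable_of_sum_le (fun n => norm_nonneg _) key
  exact ⟨hs, hs.tsum_le_of_sum_le key⟩

theorem pCo_eq_image [CompleteSpace F] {p : ℝ} (hp : 1 ≤ p) {x : ℕ → F}
    (hx : Summable fun n => ‖x n‖ ^ p) :
    pCo p x = (fun α : ℕ → ℂ => ∑' n, α n • x n) '' {α | ConjUnitBall p α} := by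
  ext y
  constructor
  · rintro ⟨α, hα, hy⟩
    exact ⟨α, hα, hy.tsum_eq⟩
  · rintro ⟨α, hα, rfl⟩
    exact ⟨α, hα, (hα.summable_norm_smul hp hx).1.of_norm.hasSum⟩

theorem isClosed_pCo [CompleteSpace F] {p : ℝ} (hp : 1 ≤ p) {x : ℕ → F}
    (hx : Summable fun n => ‖x n‖ ^ p) : IsClosed (pCo p x) := by
  rw [pCo_eq_image hp hx]
  refine ((isCompact_conjUnitBall hp).image_of_continuousOn ?_).isClosed
  have hunif : TendstoUniformlyOn (fun (s : Finset ℕ) (α : ℕ → ℂ) => ∑ n ∈ s, α n • x n)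
      (fun α => ∑' n, α n • x n) atTop {α | ConjUnitBall p α} := by
    rw [Metric.tendstoUniformlyOn_iff]
    intro ε hε
    have hp0 : 0 < p := by linarith
    obtain ⟨s₀, hs₀⟩ := summable_iff_vanishing_norm.1 hx ((ε / 2) ^ p) (by positivity)
    filter_upwards [eventually_ge_atTop s₀] with s hs α hα
    rw [dist_eq_norm]
    have hsum := (hα.summable_norm_smul hp hx).1.of_norm.hasSum
    have hlim := (hsum.sub_const (∑ n ∈ s, α n • x n)).norm
    refine (le_of_tendsto hlim ?_).trans_lt (half_lt_self hε)
    filter_upwards [eventually_ge_atTop s] with t ht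
    rw [← Finset.sum_sdiff ht, add_sub_cancel_right]
    refine (norm_sum_le _ _).trans ((hα.sum_norm_smul_le hp x _).trans ?_)
    have h1 := hs₀ (t \ s) (Finset.disjoint_of_subset_right hs Finset.sdiff_disjoint)
    calc (∑ n ∈ t \ s, ‖x n‖ ^ p) ^ (1 / p) ≤ ((ε / 2) ^ p) ^ (1 / p) :=
          Real.rpow_le_rpow (by positivity) ((Real.le_norm_self _).trans h1.le) (by positivity)
      _ = ε / 2 := by
          rw [one_div, Real.rpow_rpow_inv (by positivity) hp0.ne']
  refine hunif.continuousOn (Frequently.of_forall fun s => Continuous.continuousOn ?_)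
  exact continuous_finsetSum _ fun n _ => (continuous_apply n).smul continuous_const

theorem convex_pCo {p : ℝ} (hp : 1 ≤ p) (x : ℕ → F) : Convex ℝ (pCo p x) := by
  rintro y ⟨α, hα, hy⟩ z ⟨β, hβ, hz⟩ a b ha hb hab
  refine ⟨a • α + b • β, convex_conjUnitBall hp hα hβ ha hb hab, ?_⟩
  simpa [add_smul, mul_smul] using (hy.const_smul a).add (hz.const_smul b)

theorem balanced_pCo {p : ℝ} (hp : 1 ≤ p) (x : ℕ → F) : Balanced ℂ (pCo p x) := by
  rw [balanced_iff_smul_mem]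
  rintro a ha y ⟨α, hα, hy⟩
  refine ⟨a • α, hα.of_norm_le hp fun n => ?_, ?_⟩
  · simpa using mul_le_of_le_one_left (norm_nonneg (α n)) ha
  · simpa [smul_smul] using hy.const_smul a

theorem zero_mem_pCo {p : ℝ} (hp : 1 ≤ p) (x : ℕ → F) : (0 : F) ∈ pCo p x :=
  ⟨0, conjUnitBall_zero p hp, by simp⟩

theorem smul_mem_pCo_smul {p : ℝ} (a : ℂ) {x : ℕ → F} {y : F} (hy : y ∈ pCo p x) :
    a • y ∈ pCo p (fun n => a • x n) := by
  obtain ⟨α, hα, hy⟩ := hy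
  refine ⟨α, hα, ?_⟩
  simpa only [smul_comm a] using hy.const_smul a

theorem summable_norm_smul_rpow {p : ℝ} (a : ℂ) {x : ℕ → F} (hx : Summable fun n => ‖x n‖ ^ p) :
    Summable fun n => ‖a • x n‖ ^ p := by
  simpa only [norm_smul, Real.mul_rpow (norm_nonneg a) (norm_nonneg _)]
    using hx.mul_left (‖a‖ ^ p)

theorem IsRelPCompact.mono {p : ℝ} {K L : Set F} (h : IsRelPCompact p L) (hKL : K ⊆ L) :
    IsRelPCompact p K :=
  let ⟨x, hx, hL⟩ := h
  ⟨x, hx, hKL.trans hL⟩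

theorem IsRelPCompact.smul {p : ℝ} {K : Set F} (h : IsRelPCompact p K) (a : ℂ) :
    IsRelPCompact p (a • K) := by
  obtain ⟨x, hx, hK⟩ := h
  refine ⟨fun n => a • x n, summable_norm_smul_rpow a hx, ?_⟩
  rintro _ ⟨y, hy, rfl⟩
  exact smul_mem_pCo_smul a (hK hy)

theorem mP_nonneg (p : ℝ) (K : Set F) : 0 ≤ mP p K := by
  refine Real.sInf_nonneg ?_
  rintro _ ⟨x, -, -, rfl⟩
  positivity

theorem mP_le {p : ℝ} {K : Set F} {x : ℕ → F} (hx : Summable fun n => ‖x n‖ ^ p)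
    (hK : K ⊆ pCo p x) : mP p K ≤ (∑' n, ‖x n‖ ^ p) ^ (1 / p) := by
  refine csInf_le ⟨0, ?_⟩ ⟨x, hx, hK, rfl⟩
  rintro _ ⟨x, -, -, rfl⟩
  positivity

theorem IsRelPCompact.exists_lt {p : ℝ} {K : Set F} (h : IsRelPCompact p K) {r : ℝ}
    (hr : mP p K < r) : ∃ x : ℕ → F, (Summable fun n => ‖x n‖ ^ p) ∧ K ⊆ pCo p x ∧
      (∑' n, ‖x n‖ ^ p) ^ (1 / p) < r := by
  obtain ⟨x₀, hx₀, hK₀⟩ := h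
  obtain ⟨_, ⟨x, hx, hK, rfl⟩, hlt⟩ := exists_lt_of_csInf_lt (by exact ⟨_, x₀, hx₀, hK₀, rfl⟩) hr
  exact ⟨x, hx, hK, hlt⟩

theorem summable_prod_of_tsum_le {g : ℕ × ℕ → ℝ} (hg : ∀ k, 0 ≤ g k) {b : ℕ → ℝ}
    (hb : Summable b) (hs : ∀ m, Summable fun n => g (m, n)) (hle : ∀ m, ∑' n, g (m, n) ≤ b m) :
    Summable g ∧ ∑' k, g k ≤ ∑' m, b m := by
  have hm : Summable fun m => ∑' n, g (m, n) :=
    Summable.of_nonneg_of_le (fun m => tsum_nonneg fun n => hg _) hle hb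
  have hsum : Summable g := (summable_prod_of_nonneg hg).2 ⟨hs, hm⟩
  exact ⟨hsum, hsum.tsum_prod.trans_le (hm.tsum_le_tsum hle hb)⟩

theorem exists_pCo_of_hasSum [CompleteSpace F] {p : ℝ} (hp : 1 ≤ p) {x : ℕ → ℕ → F} {c : ℕ → ℝ}
    (hc : ∀ m, 0 < c m) (hcs : Summable c) (hx : ∀ m, Summable fun n => ‖x m n‖ ^ p)
    (hxc : ∀ m, (∑' n, ‖x m n‖ ^ p) ^ (1 / p) ≤ c m) :
    ∃ z : ℕ → F, (Summable fun n => ‖z n‖ ^ p) ∧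
      ∀ (y : ℕ → F) (s : F), (∀ m, y m ∈ pCo p (x m)) → HasSum y s → s ∈ pCo p z := by
  have hp0 : 0 < p := by linarith
  set C := ∑' m, c m with hC
  have hC0 : 0 < C := hcs.tsum_pos (fun m => (hc m).le) 0 (hc 0)
  set μ : ℕ → ℝ := fun m => (c m / C) ^ ((p - 1) / p) with hμ
  have hμ0 : ∀ m, 0 < μ m := fun m => Real.rpow_pos_of_pos (div_pos (hc m) hC0) _
  set e := Nat.pairEquiv.symm
  refine ⟨fun k => ((μ (e k).1)⁻¹ : ℂ) • x (e k).1 (e k).2, ?_, ?_⟩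
  · refine (e.summable_iff (f := fun k : ℕ × ℕ => ‖((μ k.1)⁻¹ : ℂ) • x k.1 k.2‖ ^ p)).2 ?_
    have hfac : ∀ m n, ‖((μ m)⁻¹ : ℂ) • x m n‖ ^ p = (μ m)⁻¹ ^ p * ‖x m n‖ ^ p := fun m n => by
      have h0 : ‖((μ m)⁻¹ : ℂ)‖ = (μ m)⁻¹ := by
        rw [norm_inv, Complex.norm_real, Real.norm_of_nonneg (hμ0 m).le]
      rw [norm_smul, h0, Real.mul_rpow (inv_nonneg.2 (hμ0 m).le) (norm_nonneg _)]
    refine (summable_prod_of_tsum_le (b := fun m => c m * C ^ (p - 1)) (fun k => by positivity)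
      (hcs.mul_right _) (fun m => ?_) fun m => ?_).1
    · simpa only [hfac] using (hx m).mul_left _
    · simp only [hfac]
      rw [tsum_mul_left]
      have hS : ∑' n, ‖x m n‖ ^ p ≤ c m ^ p := by
        have h0 : 0 ≤ ∑' n, ‖x m n‖ ^ p := tsum_nonneg fun n => by positivity
        have := Real.rpow_le_rpow (by positivity) (hxc m) hp0.le
        rwa [one_div, Real.rpow_inv_rpow h0 hp0.ne'] at this
      have hμp : μ m ^ p = (c m / C) ^ (p - 1) := by
        rw [hμ, ← Real.rpow_mul (div_pos (hc m) hC0).le, div_mul_cancel₀ _ hp0.ne']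
      rw [Real.inv_rpow (hμ0 m).le, hμp, Real.div_rpow (hc m).le hC0.le, inv_div]
      have hcp : c m ^ p = c m ^ (p - 1) * c m := by
        rw [Real.rpow_sub_one (hc m).ne', div_mul_cancel₀ _ (hc m).ne']
      have h1 : 0 < c m ^ (p - 1) := Real.rpow_pos_of_pos (hc m) _
      calc C ^ (p - 1) / c m ^ (p - 1) * ∑' n, ‖x m n‖ ^ p
          ≤ C ^ (p - 1) / c m ^ (p - 1) * c m ^ p := by gcongr
        _ = c m * C ^ (p - 1) := by rw [hcp]; field_simp
  · intro y s hy hs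
    choose α hα hαy using hy
    refine ⟨fun k => (μ (e k).1 : ℂ) * α (e k).1 (e k).2, ?_, ?_⟩
    · have hnorm : ∀ m n, ‖(μ m : ℂ) * α m n‖ = μ m * ‖α m n‖ := fun m n => by
        rw [norm_mul, Complex.norm_real, Real.norm_of_nonneg (hμ0 m).le]
      by_cases h1 : p = 1
      · rw [ConjUnitBall, if_pos h1]
        intro k
        have : μ (e k).1 = 1 := by simp [hμ, h1]
        rw [hnorm, this, one_mul]
        exact (hα _).norm_le_one hp _
      · have hp1 : 1 < p := lt_of_le_of_ne hp (Ne.symm h1)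
        have hα' := hα
        simp only [ConjUnitBall, if_neg h1] at hα' ⊢
        have hfac : ∀ m n, ‖(μ m : ℂ) * α m n‖ ^ (p / (p - 1)) =
            c m / C * ‖α m n‖ ^ (p / (p - 1)) := fun m n => by
          have h2 : (p - 1) / p * (p / (p - 1)) = 1 := by
            have : p - 1 ≠ 0 := by linarith
            field_simp
          rw [hnorm, Real.mul_rpow (hμ0 m).le (norm_nonneg _), hμ,
            ← Real.rpow_mul (div_pos (hc m) hC0).le, h2, Real.rpow_one]
        have key := summable_prod_of_tsum_le
          (g := fun k : ℕ × ℕ => ‖(μ k.1 : ℂ) * α k.1 k.2‖ ^ (p / (p - 1)))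
          (b := fun m => c m / C) (fun k => by positivity) (hcs.div_const _) (fun m => by
            simpa only [hfac] using (hα' m).1.mul_left _) fun m => by
            simp only [hfac]
            rw [tsum_mul_left]
            exact mul_le_of_le_one_right (div_pos (hc m) hC0).le (hα' m).2
        rw [tsum_div_const, ← hC, div_self hC0.ne'] at key
        refine ⟨(e.summable_iff (f := fun k : ℕ × ℕ =>
          ‖(μ k.1 : ℂ) * α k.1 k.2‖ ^ (p / (p - 1)))).2 key.1, ?_⟩
        exact (e.tsum_eq fun k : ℕ × ℕ => ‖(μ k.1 : ℂ) * α k.1 k.2‖ ^ (p / (p - 1))).trans_le key.2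
    · have hterm : ∀ k : ℕ × ℕ, ((μ k.1 : ℂ) * α k.1 k.2) • (((μ k.1)⁻¹ : ℂ) • x k.1 k.2) =
          α k.1 k.2 • x k.1 k.2 := fun k => by
        have : (μ k.1 : ℂ) ≠ 0 := Complex.ofReal_ne_zero.2 (hμ0 k.1).ne'
        rw [smul_smul]
        congr 1
        field_simp
      have hsum : Summable fun k : ℕ × ℕ => α k.1 k.2 • x k.1 k.2 := by
        refine Summable.of_norm (summable_prod_of_tsum_le
          (g := fun k : ℕ × ℕ => ‖α k.1 k.2 • x k.1 k.2‖) (fun k => norm_nonneg _) hcs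
          (fun m => ((hα m).summable_norm_smul hp (hx m)).1) fun m => ?_).1
        exact ((hα m).summable_norm_smul hp (hx m)).2.trans (hxc m)
      have hs' : HasSum (fun k : ℕ × ℕ => α k.1 k.2 • x k.1 k.2) s := by
        have := hsum.hasSum.prod_fiberwise hαy
        rw [← this.unique hs]
        exact hsum.hasSum
      have := (e.hasSum_iff (f := fun k : ℕ × ℕ => α k.1 k.2 • x k.1 k.2)).2 hs'
      refine this.congr_fun ?_
      exact fun k => hterm (e k)

theorem IsRelPCompact.union [CompleteSpace F] {p : ℝ} (hp : 1 ≤ p) {K L : Set F}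
    (hK : IsRelPCompact p K) (hL : IsRelPCompact p L) : IsRelPCompact p (K ∪ L) := by
  have hp0 : p ≠ 0 := by linarith
  obtain ⟨x, hx, hKx⟩ := hK
  obtain ⟨y, hy, hLy⟩ := hL
  set w : ℕ → ℕ → F := fun m => if m = 0 then x else if m = 1 then y else 0 with hw
  have hws : ∀ m, Summable fun n => ‖w m n‖ ^ p := fun m => by
    rcases m with _ | _ | m
    · simpa [hw] using hx
    · simpa [hw] using hy
    · simp [hw, Real.zero_rpow hp0]
  set r : ℕ → ℝ := fun m => (∑' n, ‖w m n‖ ^ p) ^ (1 / p) with hr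
  have hr0 : ∀ m, 0 ≤ r m := fun m => by positivity
  have hrs : Summable r := summable_of_ne_finset_zero (s := {0, 1}) fun m hm => by
    simp only [Finset.mem_insert, Finset.mem_singleton, not_or] at hm
    simp [hr, hw, hm.1, hm.2, Real.zero_rpow hp0, Real.zero_rpow (inv_ne_zero hp0)]
  obtain ⟨z, hz, hzw⟩ := exists_pCo_of_hasSum hp (x := w) (c := fun m => r m + (1 / 2) ^ m)
    (fun m => add_pos_of_nonneg_of_pos (hr0 m) (by positivity))
    (hrs.add summable_geometric_two) hws fun m => by
      change r m ≤ _
      exact le_add_of_nonneg_right (by positivity)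
  have key : ∀ m, pCo p (w m) ⊆ pCo p z := fun m v hv => by
    refine hzw (Pi.single m v) v (fun k => ?_) (hasSum_pi_single m v)
    by_cases h : k = m
    · subst h
      simpa using hv
    · simpa [h] using zero_mem_pCo hp (w k)
  exact ⟨z, hz, Set.union_subset (hKx.trans (by simpa [hw] using key 0))
    (hLy.trans (by simpa [hw] using key 1))⟩

omit [NormedSpace ℂ E] in
theorem IsCompact.exists_isRelPCompact_image_thickening [CompleteSpace F] {p : ℝ} (hp : 1 ≤ p)
    {f : E → F} (hf : ∀ x, PCompactAt p f x) {K : Set E} (hK : IsCompact K) :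
    ∃ δ > 0, IsRelPCompact p (f '' thickening δ K) := by
  refine hK.induction_on (p := fun s => ∃ δ > 0, IsRelPCompact p (f '' thickening δ s)) ?_ ?_ ?_ ?_
  · refine ⟨1, one_pos, 0, ?_, by simp⟩
    simp [Real.zero_rpow (show p ≠ 0 by linarith)]
  · rintro s t hst ⟨δ, hδ, h⟩
    exact ⟨δ, hδ, h.mono (Set.image_mono (thickening_subset_of_subset δ hst))⟩
  · rintro s t ⟨δ, hδ, h⟩ ⟨η, hη, h'⟩
    refine ⟨min δ η, lt_min hδ hη, (h.union hp h').mono ?_⟩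
    rw [thickening_union, Set.image_union]
    exact Set.union_subset_union
      (Set.image_mono (thickening_mono (min_le_left _ _) _))
      (Set.image_mono (thickening_mono (min_le_right _ _) _))
  · intro x _
    obtain ⟨V, hV, h⟩ := hf x
    obtain ⟨r, hr, hrV⟩ := Metric.mem_nhds_iff.1 hV
    refine ⟨ball x (r / 2), mem_nhdsWithin_of_mem_nhds (ball_mem_nhds x (half_pos hr)), r / 2,
      half_pos hr, h.mono (Set.image_mono (Set.Subset.trans ?_ hrV))⟩
    simpa using thickening_ball x (r / 2) (r / 2)

theorem taylorPoly_smul (f : E → F) (x₀ : E) (m : ℕ) (a : ℂ) (x : E) :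
    taylorPoly f x₀ m (a • x) = a ^ m • taylorPoly f x₀ m x := by
  have := (iteratedFDeriv ℂ m f x₀).map_smul_univ (fun _ => a) fun _ => x
  simp only [Finset.prod_const, Finset.card_univ, Fintype.card_fin] at this
  rw [taylorPoly, taylorPoly, this, smul_comm]

theorem iteratedDeriv_comp_smul_right {f : E → F} (hf : ContDiff ℂ ⊤ f) (x : E) (m : ℕ) :
    ((m.factorial : ℂ))⁻¹ • iteratedDeriv m (fun ζ : ℂ => f (ζ • x)) 0 = taylorPoly f 0 m x := by
  have h := (ContinuousLinearMap.toSpanSingleton ℂ x).iteratedFDeriv_comp_right hf (0 : ℂ)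
    (i := m) le_top
  have h2 : (f ∘ ContinuousLinearMap.toSpanSingleton ℂ x) = fun ζ : ℂ => f (ζ • x) := by
    ext ζ; simp
  rw [h2] at h
  rw [iteratedDeriv_eq_iteratedFDeriv, h, taylorPoly]
  simp

theorem hasSum_taylorPoly [CompleteSpace F] {f : E → F} (hf : ContDiff ℂ ⊤ f) (x : E) :
    HasSum (fun m => taylorPoly f 0 m x) (f x) := by
  have hd : Differentiable ℂ fun ζ : ℂ => f (ζ • x) :=
    (hf.differentiable (by simp)).comp (differentiable_id.smul_const x)
  simpa [iteratedDeriv_comp_smul_right hf] using Complex.hasSum_taylorSeries_of_entire hd 0 1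

theorem taylorPoly_mem_of_circle [CompleteSpace F] {f : E → F} (hf : ContDiff ℂ ⊤ f) (x : E)
    (m : ℕ) {R : ℝ} (hR : 0 < R) {S : Set F} (hS : Convex ℝ S) (hSc : IsClosed S)
    (hSb : Balanced ℂ S) (h : ∀ ζ : ℂ, ‖ζ‖ = R → f (ζ • x) ∈ S) :
    ((R : ℂ) ^ m) • taylorPoly f 0 m x ∈ S := by
  have hd : Differentiable ℂ fun ζ : ℂ => f (ζ • x) :=
    (hf.differentiable (by simp)).comp (differentiable_id.smul_const x)
  have hcauchy := hd.differentiableOn (s := closedBall (0 : ℂ) R)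
    |>.circleIntegral_one_div_sub_center_pow_smul hR m
  set g : ℂ → F := fun ζ => ((R : ℂ) ^ m * (ζ ^ m)⁻¹) • f (ζ • x) with hg
  have hgS : ∀ ζ ∈ sphere (0 : ℂ) R, g ζ ∈ S := fun ζ hζ => by
    have hζ : ‖ζ‖ = R := by simpa using hζ
    refine hSb.smul_mem ?_ (h ζ hζ)
    rw [norm_mul, norm_inv, norm_pow, norm_pow, hζ, Complex.norm_real,
      Real.norm_of_nonneg hR.le, mul_inv_cancel₀ (by positivity)]
  have hgc : Continuous fun θ : ℝ => g (circleMap 0 R θ) := by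
    have h0 : ∀ θ : ℝ, circleMap 0 R θ ^ m ≠ 0 := fun θ =>
      pow_ne_zero _ (circleMap_ne_center hR.ne')
    exact (continuous_const.mul (((continuous_circleMap 0 R).pow m).inv₀ h0)).smul
      (hd.continuous.comp (continuous_circleMap 0 R))
  have havg : Real.circleAverage g 0 R ∈ S := by
    rw [Real.circleAverage_eq_intervalAverage]
    refine hS.set_average_mem hSc ?_ ?_ (Eventually.of_forall fun θ =>
      hgS _ (circleMap_mem_sphere 0 hR.le θ)) ?_
    · simp [Set.uIoc_of_le Real.two_pi_pos.le, Real.pi_pos]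
    · simp [Set.uIoc_of_le Real.two_pi_pos.le, ENNReal.mul_eq_top]
    · exact (hgc.intervalIntegrable 0 (2 * Real.pi)).def'
  convert havg using 1
  rw [Real.circleAverage_eq_circleIntegral hR.ne']
  have hint : ∮ z in C(0, R), (z - 0)⁻¹ • g z =
      (R : ℂ) ^ m • ∮ z in C(0, R), (1 / (z - 0) ^ (m + 1)) • f (z • x) := by
    rw [← circleIntegral.integral_smul]
    refine circleIntegral.integral_congr hR.le fun z _ => ?_
    simp only [hg, smul_smul, sub_zero]
    congr 1
    rw [one_div, pow_succ, mul_inv]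
    ring
  have hπ : (2 * Real.pi * Complex.I : ℂ) ≠ 0 := Complex.two_pi_I_ne_zero
  rw [hint, hcauchy, ← iteratedDeriv_comp_smul_right hf]
  simp only [smul_smul]
  congr 1
  field_simp

theorem IsRelPCompact.image_taylorPoly_closedBall {p : ℝ} {f : E → F} {x₀ : E} {m : ℕ} {S : Set E}
    (h : IsRelPCompact p (taylorPoly f x₀ m '' S)) {r : ℝ} (hr : 0 < r) (hS : closedBall 0 r ⊆ S)
    (R : ℝ) : IsRelPCompact p (taylorPoly f x₀ m '' closedBall 0 R) := by
  have hR : 0 < |R| + 1 := by positivity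
  refine (h.smul ((((|R| + 1) / r : ℝ) : ℂ) ^ m)).mono ?_
  rintro _ ⟨x, hx, rfl⟩
  have hx : ‖x‖ ≤ R := by simpa using hx
  refine ⟨_, ⟨((r / (|R| + 1) : ℝ) : ℂ) • x, hS ?_, rfl⟩, ?_⟩
  · rw [mem_closedBall_zero_iff, norm_smul, Complex.norm_real, Real.norm_of_nonneg (by positivity),
      div_mul_eq_mul_div, div_le_iff₀ hR]
    gcongr
    exact hx.trans ((le_abs_self R).trans (by linarith))
  · change _ • taylorPoly f x₀ m _ = _
    rw [← taylorPoly_smul, smul_smul, ← Complex.ofReal_mul, div_mul_div_cancel₀ hr.ne', div_self hR.ne']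
    simp

/-- **Proposition 5.4.** Let `E`, `F` be complex Banach spaces and `1 ≤ p < ∞`.  An entire
function `f : E → F` is `p`-compact (at every point) if and only if every Taylor polynomial
`P_mf(0)` is `p`-compact and for every absolutely convex compact set `K ⊆ E` there exists
`ε > 0` such that `∑_m m_p(P_mf(0)(K + εB_E)) < ∞`. -/
theorem statement18 [CompleteSpace E] [CompleteSpace F] (p : ℝ) (hp : 1 ≤ p)
    (f : E → F) (hf : ∀ x, AnalyticAt ℂ f x) :
    (∀ x : E, PCompactAt p f x) ↔
      ((∀ m : ℕ, IsRelPCompact p (taylorPoly f 0 m '' closedBall 0 1)) ∧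
        ∀ K : Set E, IsCompact K → Convex ℝ K → Balanced ℂ K →
          ∃ ε : ℝ, 0 < ε ∧
            Summable fun m : ℕ =>
              mP p (taylorPoly f 0 m '' (K + closedBall (0 : E) ε))) := by
  have hp0 : 0 < p := by linarith
  have hfc : ContDiff ℂ ⊤ f := AnalyticOnNhd.contDiff fun x _ => hf x
  constructor
  · intro hpc
    have key : ∀ K : Set E, IsCompact K → Balanced ℂ K → ∃ ε > 0, ∃ x : ℕ → F,
        (Summable fun n => ‖x n‖ ^ p) ∧ ∀ m, taylorPoly f 0 m '' (K + closedBall (0 : E) ε) ⊆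
          pCo p fun n => ((2 : ℂ) ^ m)⁻¹ • x n := by
      intro K hK hKb
      obtain ⟨δ, hδ, x, hx, hsub⟩ :=
        (hK.smul (2 : ℂ)).exists_isRelPCompact_image_thickening hp hpc
      refine ⟨δ / 4, by positivity, x, hx, ?_⟩
      rintro m _ ⟨_, ⟨k, hk, e, he, rfl⟩, rfl⟩
      have hmem := taylorPoly_mem_of_circle hfc (k + e) m two_pos (convex_pCo hp x)
        (isClosed_pCo hp hx) (balanced_pCo hp x) fun ζ hζ => by
          refine hsub ⟨_, mem_thickening_iff.2 ⟨ζ • k, ?_, ?_⟩, rfl⟩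
          · refine ⟨((2 : ℂ)⁻¹ * ζ) • k, hKb.smul_mem (by simp [hζ]) hk, ?_⟩
            simp [smul_smul]
          · have he : ‖e‖ ≤ δ / 4 := by simpa using he
            rw [dist_eq_norm, smul_add, add_sub_cancel_left, norm_smul, hζ]
            linarith
      have h := smul_mem_pCo_smul ((2 : ℂ) ^ m)⁻¹ hmem
      simpa [smul_smul] using h
    refine ⟨fun m => ?_, fun K hK _ hKb => ?_⟩
    · obtain ⟨ε, hε, x, hx, hsub⟩ := key {0} isCompact_singleton (by
        rw [balanced_iff_smul_mem]; simp)
      have hrel : IsRelPCompact p (taylorPoly f 0 m '' ({0} + closedBall (0 : E) ε)) :=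
        ⟨_, summable_norm_smul_rpow _ hx, hsub m⟩
      exact hrel.image_taylorPoly_closedBall hε (by simp) 1
    · obtain ⟨ε, hε, x, hx, hsub⟩ := key K hK hKb
      refine ⟨ε, hε, Summable.of_nonneg_of_le (fun m => mP_nonneg p _)
        (fun m => (mP_le (summable_norm_smul_rpow _ hx) (hsub m)).trans_eq ?_)
        (summable_geometric_two.mul_right ((∑' n, ‖x n‖ ^ p) ^ (1 / p)))⟩
      have hfac : ∀ n, ‖((2 : ℂ) ^ m)⁻¹ • x n‖ ^ p = ((1 / 2 : ℝ) ^ m) ^ p * ‖x n‖ ^ p := fun n => by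
        rw [norm_smul, Real.mul_rpow (norm_nonneg _) (norm_nonneg _)]
        simp
      simp only [hfac]
      rw [tsum_mul_left, Real.mul_rpow (by positivity) (tsum_nonneg fun n => by positivity), one_div p,
        Real.rpow_rpow_inv (by positivity) hp0.ne']
  · rintro ⟨hP, hK⟩ x₀
    obtain ⟨ε, hε, hsum⟩ := hK ((fun ζ : ℂ => ζ • x₀) '' closedBall 0 1)
      ((isCompact_closedBall 0 1).image (by fun_prop))
      ((convex_closedBall (0 : ℂ) 1).is_linear_image
        ⟨fun a b => add_smul a b x₀, fun a b => smul_assoc a b x₀⟩) (by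
        rw [balanced_iff_smul_mem]
        rintro a ha _ ⟨ζ, hζ, rfl⟩
        refine ⟨a * ζ, ?_, mul_smul a ζ x₀⟩
        have hζ : ‖ζ‖ ≤ 1 := by simpa using hζ
        simpa using mul_le_one₀ ha (norm_nonneg ζ) hζ)
    set A := (fun ζ : ℂ => ζ • x₀) '' closedBall 0 1 + closedBall (0 : E) ε with hA
    have hAR : A ⊆ closedBall 0 (‖x₀‖ + ε) := by
      rintro _ ⟨_, ⟨ζ, hζ, rfl⟩, e, he, rfl⟩
      have hζ : ‖ζ‖ ≤ 1 := by simpa using hζ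
      have he : ‖e‖ ≤ ε := by simpa using he
      rw [mem_closedBall_zero_iff]
      refine (norm_add_le _ _).trans (add_le_add ?_ he)
      rw [norm_smul]
      exact mul_le_of_le_one_left (norm_nonneg _) hζ
    have hrel : ∀ m, IsRelPCompact p (taylorPoly f 0 m '' A) := fun m =>
      ((hP m).image_taylorPoly_closedBall one_pos subset_rfl _).mono (Set.image_mono hAR)
    choose x hx hsub hlt using fun m => (hrel m).exists_lt
      (r := mP p (taylorPoly f 0 m '' A) + (1 / 2) ^ m) (lt_add_of_pos_right _ (by positivity))
    obtain ⟨z, hz, hzx⟩ := exists_pCo_of_hasSum hp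
      (fun m => add_pos_of_nonneg_of_pos (mP_nonneg p _) (by positivity))
      (hsum.add summable_geometric_two) hx fun m => (hlt m).le
    refine ⟨closedBall x₀ ε, closedBall_mem_nhds x₀ hε, z, hz, ?_⟩
    rintro _ ⟨v, hv, rfl⟩
    refine hzx _ _ (fun m => hsub m ⟨v, ?_, rfl⟩) (hasSum_taylorPoly hfc v)
    exact ⟨x₀, ⟨1, by simp, one_smul ℂ x₀⟩, v - x₀, by simpa [dist_eq_norm] using hv, by simp⟩

end
end
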